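/- arXiv:2410.05441 — 4 statements merged into one kernel-verified Lean document; each statement's English description precedes it below -/
import Mathlib

section
/- Define f(t,m,λ) := (1+λ)·( ln t + (m+2)·ln ln t + (m/2)·ln(1 + e/λ) ). Then for all real t > 23, all integers m ≥ 1, and all real λ > 0: f(t,m,λ)/f(t/2,m,λ) ≤ f(23,1,λ)/f(23/2,1,λ) ≤ 1.282. -/
open Real

lemma log_le_of_le_sum_range {x y : ℝ} (n : ℕ) (hy : 0 < y) (hx : 0 ≤ x)
    (h : y ≤ ∑ i ∈ Finset.range n, x ^ i / (Nat.factorial i : ℝ)) : log y ≤ x :=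
  (log_le_iff_le_exp hy).2 (h.trans (Real.sum_le_exp_of_nonneg hx n))

lemma log_twentythree_halves_gt : (2.4423 : ℝ) ≤ log (23 / 2) := by
  have h : exp (2.4423 / 4 : ℝ) ≤ 1.84151 := by
    refine (Real.exp_bound' (n := 9) (by norm_num) (by norm_num) (by norm_num)).trans ?_
    norm_num [Finset.sum_range_succ, Nat.factorial]
  rw [le_log_iff_exp_le (by norm_num)]
  calc exp (2.4423 : ℝ) = exp (2.4423 / 4 : ℝ) ^ 4 := by rw [← exp_nat_mul]; norm_num
    _ ≤ 1.84151 ^ 4 := by gcongr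
    _ ≤ 23 / 2 := by norm_num

lemma log_twentythree_halves_lt : log (23 / 2) ≤ (2.443 : ℝ) :=
  log_le_of_le_sum_range 14 (by norm_num) (by norm_num)
    (by norm_num [Finset.sum_range_succ, Nat.factorial])

lemma log_log_twentythree_halves_gt : (0.8929 : ℝ) ≤ log (log (23 / 2)) := by
  have ha := log_twentythree_halves_gt
  rw [le_log_iff_exp_le (by linarith)]
  refine le_trans ?_ ha
  refine (Real.exp_bound' (n := 9) (by norm_num) (by norm_num) (by norm_num)).trans ?_
  norm_num [Finset.sum_range_succ, Nat.factorial]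

lemma log_one_add_log_two_div_lt : log (1 + log 2 / log (23 / 2)) ≤ (0.2499 : ℝ) := by
  have ha := log_twentythree_halves_gt
  have h2 := Real.log_two_lt_d9
  have h0 := Real.log_two_gt_d9
  have hq : log 2 / log (23 / 2) ≤ (0.28382 : ℝ) := by
    rw [div_le_iff₀ (by linarith)]
    linarith
  have hq0 : 0 ≤ log 2 / log (23 / 2) := div_nonneg (by linarith) (by linarith)
  refine log_le_of_le_sum_range 7 (by linarith) (by norm_num) ?_
  refine (add_le_add_right hq 1).trans ?_
  norm_num [Finset.sum_range_succ, Nat.factorial]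

/-- Doubling the argument of `log ∘ log`. -/
lemma log_log_eq_add_of_half {t : ℝ} (ht : 2 < t) :
    log (log t) = log (log (t / 2)) + log (1 + log 2 / log (t / 2)) := by
  have hA : 0 < log (t / 2) := log_pos (by linarith)
  have h2 : 0 < log 2 := log_pos (by norm_num)
  rw [← log_mul hA.ne' (by positivity), mul_add, mul_div_cancel₀ _ hA.ne', mul_one,
    log_div (by linarith) (by norm_num), sub_add_cancel]

/-- The ratio at `t` and `t / 2`, written as one plus its relative increment. -/
lemma ratio_eq_one_add {t c L : ℝ} (ht : 2 < t)
    (hden : 0 < log (t / 2) + c * log (log (t / 2)) + L) :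
    (log t + c * log (log t) + L) / (log (t / 2) + c * log (log (t / 2)) + L) =
      1 + (log 2 + c * log (1 + log 2 / log (t / 2))) /
        (log (t / 2) + c * log (log (t / 2)) + L) := by
  have h : log t = log (t / 2) + log 2 := by
    rw [log_div (by linarith) (by norm_num), sub_add_cancel]
  rw [log_log_eq_add_of_half ht, h, eq_comm, one_add_div hden.ne']
  ring

/-- The ratio `f(t,m,λ)/f(t/2,m,λ)` for the exploration function
`f(t,m,λ) = (1+λ)(ln t + (m+2) ln ln t + (m/2) ln(1 + e/λ))` is maximized at
`t = 23`, `m = 1`, and this maximum is at most `1.282`. -/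
theorem exploration_function_ratio_bound
    (f : ℝ → ℕ → ℝ → ℝ)
    (hf : ∀ (t : ℝ) (m : ℕ) (lam : ℝ),
      f t m lam = (1 + lam) * (Real.log t + ((m : ℝ) + 2) * Real.log (Real.log t) +
        (m : ℝ) / 2 * Real.log (1 + Real.exp 1 / lam)))
    (t : ℝ) (ht : 23 < t) (m : ℕ) (hm : 1 ≤ m) (lam : ℝ) (hlam : 0 < lam) :
    f t m lam / f (t / 2) m lam ≤ f 23 1 lam / f (23 / 2) 1 lam ∧
      f 23 1 lam / f (23 / 2) 1 lam ≤ 1.282 := by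
  have ha := log_twentythree_halves_gt
  have ha' := log_twentythree_halves_lt
  have hb := log_log_twentythree_halves_gt
  have hd := log_one_add_log_two_div_lt
  have h2 := Real.log_two_gt_d9
  have h2' := Real.log_two_lt_d9
  have hL : 0 ≤ log (1 + exp 1 / lam) :=
    log_nonneg (le_add_of_nonneg_right (by positivity))
  have haA : log (23 / 2) ≤ log (t / 2) := log_le_log (by norm_num) (by linarith)
  have hbB : log (log (23 / 2)) ≤ log (log (t / 2)) := log_le_log (by linarith) haA
  have hA : 0 < log (t / 2) := by linarith
  have hδ0 : 0 ≤ log 2 / log (t / 2) := div_nonneg (by linarith) hA.le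
  have hδd : log (1 + log 2 / log (t / 2)) ≤ log (1 + log 2 / log (23 / 2)) := by
    apply log_le_log (by linarith)
    gcongr
  have hδ : 0 ≤ log (1 + log 2 / log (t / 2)) := log_nonneg (by linarith)
  have hm' : (1 : ℝ) ≤ m := by exact_mod_cast hm
  have hlam1 : 1 + lam ≠ 0 := by positivity
  simp only [hf, mul_div_mul_left _ _ hlam1, Nat.cast_one]
  have hp1 : 0 < log (23 / 2) + (1 + 2) * log (log (23 / 2)) +
      1 / 2 * log (1 + exp 1 / lam) := by linarith
  have hpm : 0 < log (23 / 2) + ((m : ℝ) + 2) * log (log (23 / 2)) +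
      (m : ℝ) / 2 * log (1 + exp 1 / lam) := by
    have : 0 < log (23 / 2) := by linarith
    have : 0 < log (log (23 / 2)) := by linarith
    positivity
  have hle : log (23 / 2) + ((m : ℝ) + 2) * log (log (23 / 2)) +
      (m : ℝ) / 2 * log (1 + exp 1 / lam) ≤ log (t / 2) + ((m : ℝ) + 2) * log (log (t / 2)) +
      (m : ℝ) / 2 * log (1 + exp 1 / lam) := by gcongr
  rw [ratio_eq_one_add (by linarith) (hpm.trans_le hle), ratio_eq_one_add (by norm_num) hp1]
  generalize log (1 + log 2 / log (t / 2)) = δ at *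
  generalize log (1 + log 2 / log (23 / 2)) = d at *
  generalize log (log (23 / 2)) = b at *
  generalize log (23 / 2) = a at *
  generalize log (1 + exp 1 / lam) = L at *
  have hd0 : 0 ≤ d := hδ.trans hδd
  constructor
  · gcongr 1 + ?_
    calc _ ≤ (log 2 + ((m : ℝ) + 2) * d) / (a + ((m : ℝ) + 2) * b + (m : ℝ) / 2 * L) := by
          have : 0 ≤ log 2 := by linarith
          gcongr
      _ ≤ _ := by
          rw [div_le_div_iff₀ hpm hp1]
          have h1 : d * a ≤ log 2 * b := by
            calc d * a ≤ 0.2499 * 2.443 := by gcongr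
              _ ≤ 0.69 * 0.8929 := by norm_num
              _ ≤ log 2 * b := by gcongr; linarith
          have h3 : 0 ≤ log 2 * b - d * a + (log 2 / 2 + d) * L := by
            have : 0 ≤ (log 2 / 2 + d) * L := mul_nonneg (by linarith) hL
            linarith
          nlinarith [mul_nonneg (sub_nonneg.2 hm') h3]
  · have : (log 2 + (1 + 2) * d) / (a + (1 + 2) * b + 1 / 2 * L) ≤ 0.282 := by
      rw [div_le_iff₀ hp1]
      linarith
    linarith
end

section
/- The function f(t) := ( ln t + 3·ln ln t ) / ( ln(t/2) + 3·ln ln(t/2) ) is strictly decreasing on (2e, ∞). -/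
open Real

/-- For `c > 0`, the quotient `g (u + c) / g u` with `g x = x + 3 ln x` strictly decreases in
`u > 1`: `g` is positive and strictly increasing, and its increments over steps of length `c`
decrease by concavity. -/
theorem add_three_mul_log_shift_div_lt {c u v : ℝ} (hc : 0 < c) (hu : 1 < u) (huv : u < v) :
    (v + c + 3 * log (v + c)) / (v + 3 * log v) <
      (u + c + 3 * log (u + c)) / (u + 3 * log u) := by
  have hlogu : 0 < log u := log_pos hu
  have hloguv : log u < log v := log_lt_log (by linarith) huv
  have hstep : log u < log (u + c) := log_lt_log (by linarith) (by linarith)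
  have hconcave : log (v + c) + log u ≤ log (u + c) + log v := by
    rw [← log_mul (by linarith) (by linarith), ← log_mul (by linarith) (by linarith)]
    exact log_le_log (mul_pos (by linarith) (by linarith)) (by nlinarith)
  rw [div_lt_div_iff₀ (by linarith) (by linarith)]
  have hle : (u + 3 * log u) * (c + 3 * (log (v + c) - log v)) ≤
      (u + 3 * log u) * (c + 3 * (log (u + c) - log u)) :=
    mul_le_mul_of_nonneg_left (by linarith) (by linarith)
  have hlt : (u + 3 * log u) * (c + 3 * (log (u + c) - log u)) <
      (v + 3 * log v) * (c + 3 * (log (u + c) - log u)) :=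
    mul_lt_mul_of_pos_right (by linarith) (by linarith)
  linarith

/-- The function `t ↦ (ln t + 3 ln ln t)/(ln(t/2) + 3 ln ln(t/2))` is strictly
decreasing on `(2e, ∞)`. -/
theorem log_ratio_strict_anti :
    StrictAntiOn (fun t : ℝ =>
        (Real.log t + 3 * Real.log (Real.log t)) /
          (Real.log (t / 2) + 3 * Real.log (Real.log (t / 2))))
      (Set.Ioi (2 * Real.exp 1)) := by
  intro s hs t _ hst
  rw [Set.mem_Ioi] at hs
  have he : 0 < exp 1 := exp_pos 1
  have log_half_add {x : ℝ} (hx : 0 < x) : log x = log (x / 2) + log 2 := by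
    rw [log_div hx.ne' two_ne_zero, sub_add_cancel]
  have hone : 1 < log (s / 2) := (lt_log_iff_exp_lt (by linarith)).2 (by linarith)
  have hlt : log (s / 2) < log (t / 2) := log_lt_log (by linarith) (by linarith)
  simpa only [← log_half_add (show 0 < s by linarith), ← log_half_add (show 0 < t by linarith)]
    using add_three_mul_log_shift_div_lt (log_pos one_lt_two) hone hlt
end

section
/- Let c > 1 be a real constant. Then for all real t > 2e, Q( c·√(ln(t/2)) ) ≥ (1/√(2π)) · (1/(2c)) · (t/2)^{ −(c² + 1/2)/2 }. -/
open Real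

theorem integrable_exp_neg_sq_div_two :
    MeasureTheory.Integrable fun z : ℝ => Real.exp (-z ^ 2 / 2) := by
  convert integrable_exp_neg_mul_sq (b := 1 / 2) (by norm_num) using 3
  ring

theorem hasDerivAt_neg_exp_neg_sq_div_two_div {z : ℝ} (hz : z ≠ 0) :
    HasDerivAt (fun z : ℝ => -(Real.exp (-z ^ 2 / 2) / (2 * z)))
      (Real.exp (-z ^ 2 / 2) * (1 / 2 + 1 / (2 * z ^ 2))) z := by
  have h : HasDerivAt (fun z : ℝ => -z ^ 2 / 2) (-z) z := by
    refine ((hasDerivAt_pow 2 z).neg.div_const 2).congr_deriv ?_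
    norm_num
    ring
  have h2 : HasDerivAt (fun z : ℝ => 2 * z) 2 z := by
    simpa using (hasDerivAt_id z).const_mul (2 : ℝ)
  refine (h.exp.div h2 (by simpa using hz)).neg.congr_deriv ?_
  field_simp
  ring

theorem tendsto_neg_exp_neg_sq_div_two_div :
    Filter.Tendsto (fun z : ℝ => -(Real.exp (-z ^ 2 / 2) / (2 * z))) Filter.atTop (nhds 0) := by
  have hinv : Filter.Tendsto (fun z : ℝ => -z⁻¹) Filter.atTop (nhds 0) := by
    simpa using tendsto_inv_atTop_zero (𝕜 := ℝ).neg
  refine tendsto_of_tendsto_of_tendsto_of_le_of_le' hinv tendsto_const_nhds ?_ ?_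
  · filter_upwards [Filter.eventually_gt_atTop 0] with z hz
    have he : Real.exp (-z ^ 2 / 2) ≤ 1 := Real.exp_le_one_iff.2 (by nlinarith [sq_nonneg z])
    rw [neg_le_neg_iff, inv_eq_one_div]
    exact div_le_div₀ zero_le_one he hz (by linarith)
  · filter_upwards [Filter.eventually_gt_atTop 0] with z hz
    have : 0 ≤ Real.exp (-z ^ 2 / 2) / (2 * z) := by positivity
    linarith

/-- A Mills-ratio lower bound for the Gaussian tail integral. -/
theorem exp_neg_sq_div_two_div_le_integral_Ioi {x : ℝ} (hx : 1 ≤ x) :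
    Real.exp (-x ^ 2 / 2) / (2 * x) ≤ ∫ z in Set.Ioi x, Real.exp (-z ^ 2 / 2) := by
  have hderiv : ∀ z ∈ Set.Ici x, HasDerivAt (fun z : ℝ => -(Real.exp (-z ^ 2 / 2) / (2 * z)))
      (Real.exp (-z ^ 2 / 2) * (1 / 2 + 1 / (2 * z ^ 2))) z := fun z hz =>
    hasDerivAt_neg_exp_neg_sq_div_two_div (by linarith [Set.mem_Ici.1 hz])
  have hint := MeasureTheory.integrableOn_Ioi_deriv_of_nonneg' hderiv
    (fun z _ => by positivity) tendsto_neg_exp_neg_sq_div_two_div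
  have heq := MeasureTheory.integral_Ioi_of_hasDerivAt_of_tendsto' hderiv hint
    tendsto_neg_exp_neg_sq_div_two_div
  rw [zero_sub, neg_neg] at heq
  rw [← heq]
  refine MeasureTheory.setIntegral_mono_on hint
    integrable_exp_neg_sq_div_two.integrableOn measurableSet_Ioi fun z hz => ?_
  have hz1 : 1 ≤ z := hx.trans (le_of_lt hz)
  have hle : 1 / (2 * z ^ 2) ≤ 1 / 2 :=
    one_div_le_one_div_of_le two_pos (by nlinarith)
  exact mul_le_of_le_one_right (Real.exp_pos _).le (by linarith)

theorem sqrt_le_exp_div_four {s : ℝ} (hs : 0 ≤ s) : Real.sqrt s ≤ Real.exp (s / 4) := by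
  refine Real.sqrt_le_iff.2 ⟨(Real.exp_pos _).le, ?_⟩
  rw [← Real.exp_nat_mul]
  have h := Real.quadratic_le_exp_of_nonneg (x := ((2 : ℕ) : ℝ) * (s / 4)) (by positivity)
  push_cast at h ⊢
  nlinarith [sq_nonneg (s - 2)]

/-- Lower bound on the Gaussian tail function at `c √(ln(t/2))`: for `c > 1` and
`t > 2e`, `Q(c √(ln(t/2))) ≥ (1/√(2π)) (1/(2c)) (t/2)^{-(c²+1/2)/2}`. -/
theorem gaussian_tail_polynomial_lower_bound (Q : ℝ → ℝ)
    (hQ : ∀ x, Q x = (Real.sqrt (2 * π))⁻¹ * ∫ z in Set.Ioi x, Real.exp (-z ^ 2 / 2))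
    (c : ℝ) (hc : 1 < c) (t : ℝ) (ht : 2 * Real.exp 1 < t) :
    (Real.sqrt (2 * π))⁻¹ * (1 / (2 * c)) * (t / 2) ^ (-(c ^ 2 + 1 / 2) / 2)
      ≤ Q (c * Real.sqrt (Real.log (t / 2))) := by
  have hexp : Real.exp 1 < t / 2 := by linarith
  have hpos : 0 < t / 2 := (Real.exp_pos 1).trans hexp
  have hs : 1 < Real.log (t / 2) := (Real.lt_log_iff_exp_lt hpos).2 hexp
  rw [hQ, mul_assoc, Real.rpow_def_of_pos hpos]
  generalize Real.log (t / 2) = s at hs ⊢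
  have hsqrt : 1 ≤ Real.sqrt s := Real.one_le_sqrt.2 hs.le
  have hx : 1 ≤ c * Real.sqrt s := by nlinarith
  refine mul_le_mul_of_nonneg_left ?_ (by positivity)
  refine le_trans ?_ (exp_neg_sq_div_two_div_le_integral_Ioi hx)
  have hsplit : Real.exp (-(c * Real.sqrt s) ^ 2 / 2)
      = Real.exp (s * (-(c ^ 2 + 1 / 2) / 2)) * Real.exp (s / 4) := by
    rw [← Real.exp_add, mul_pow, Real.sq_sqrt (by linarith)]
    ring_nf
  rw [hsplit, le_div_iff₀ (by linarith)]
  have hc0 : c ≠ 0 := by linarith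
  calc 1 / (2 * c) * Real.exp (s * (-(c ^ 2 + 1 / 2) / 2)) * (2 * (c * Real.sqrt s))
      = Real.exp (s * (-(c ^ 2 + 1 / 2) / 2)) * Real.sqrt s := by field_simp
    _ ≤ _ := mul_le_mul_of_nonneg_left (sqrt_le_exp_div_four (by linarith)) (Real.exp_pos _).le
end

section
/- Let C₃ > 0 be the real constant with C₃² = 1.238, let α = 3/4 − C₃²/2, and let C₂ = 1 / ( 2^{13/4 + C₃²/2} · C₃ · √(2π) ). Then for every real t ≥ 23, (t/2) · Q( C₃·√(ln(t/2)) ) ≥ 2 C₂ t^α. -/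
open Real

/-- The unnormalised Gaussian tail at `x ≥ 0` is bounded below by the minimum of the integrand on
`[x, x + 1]`. -/
theorem exp_le_integral_Ioi_gaussian {x : ℝ} (hx : 0 ≤ x) :
    Real.exp (-(x + 1) ^ 2 / 2) ≤ ∫ z in Set.Ioi x, Real.exp (-z ^ 2 / 2) := by
  have hint : MeasureTheory.Integrable (fun z : ℝ => Real.exp (-z ^ 2 / 2)) := by
    convert integrable_exp_neg_mul_sq (b := 1 / 2) (by norm_num) using 3
    ring
  calc Real.exp (-(x + 1) ^ 2 / 2)
      = ∫ _ in Set.Ioc x (x + 1), Real.exp (-(x + 1) ^ 2 / 2) := by simp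
    _ ≤ ∫ z in Set.Ioc x (x + 1), Real.exp (-z ^ 2 / 2) := by
        refine MeasureTheory.setIntegral_mono_on (by simp) hint.integrableOn
          measurableSet_Ioc fun z hz => ?_
        have h : z ^ 2 ≤ (x + 1) ^ 2 := pow_le_pow_left₀ (hx.trans hz.1.le) hz.2 2
        gcongr
    _ ≤ ∫ z in Set.Ioi x, Real.exp (-z ^ 2 / 2) :=
        MeasureTheory.setIntegral_mono_set hint.integrableOn
          (Filter.Eventually.of_forall fun _ => (Real.exp_pos _).le)
          Set.Ioc_subset_Ioi_self.eventuallyLE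

/-- With `C₃² = 1.238`, `α = 3/4 - C₃²/2` and
`C₂ = 1/(2^{13/4 + C₃²/2} C₃ √(2π))`, for all `t ≥ 23` we have
`(t/2) Q(C₃ √(ln(t/2))) ≥ 2 C₂ t^α`, where `Q` is the standard Gaussian tail. -/
theorem gaussian_tail_times_t_ge (Q : ℝ → ℝ)
    (hQ : ∀ x, Q x = (Real.sqrt (2 * π))⁻¹ * ∫ z in Set.Ioi x, Real.exp (-z ^ 2 / 2))
    (C₃ α C₂ : ℝ) (hC₃pos : 0 < C₃) (hC₃ : C₃ ^ 2 = 1.238)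
    (hα : α = 3 / 4 - C₃ ^ 2 / 2)
    (hC₂ : C₂ = 1 / (2 ^ ((13 : ℝ) / 4 + C₃ ^ 2 / 2) * C₃ * Real.sqrt (2 * π)))
    (t : ℝ) (ht : 23 ≤ t) :
    2 * C₂ * t ^ α ≤ t / 2 * Q (C₃ * Real.sqrt (Real.log (t / 2))) := by
  have ht0 : 0 < t := by linarith
  have hlog : 0 ≤ Real.log (t / 2) := Real.log_nonneg (by linarith)
  have hlt : Real.log t = Real.log (t / 2) + Real.log 2 := by
    rw [Real.log_div ht0.ne' two_ne_zero]; ring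
  have hC₃one : 1 ≤ C₃ := by nlinarith
  have hu : Real.sqrt (Real.log (t / 2)) ^ 2 = Real.log (t / 2) := Real.sq_sqrt hlog
  have htail := exp_le_integral_Ioi_gaussian
    (mul_nonneg hC₃pos.le (Real.sqrt_nonneg (Real.log (t / 2))))
  have hrpow : (2 : ℝ) * t ^ α / 2 ^ ((13 : ℝ) / 4 + C₃ ^ 2 / 2)
      = Real.exp (Real.log 2 + Real.log t * α
          - Real.log 2 * ((13 : ℝ) / 4 + C₃ ^ 2 / 2)) := by
    rw [Real.exp_sub, Real.exp_add, Real.exp_log two_pos, Real.rpow_def_of_pos ht0,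
      Real.rpow_def_of_pos two_pos]
  have hexp : (2 : ℝ) * t ^ α / 2 ^ ((13 : ℝ) / 4 + C₃ ^ 2 / 2)
      ≤ t / 2 * Real.exp (-(C₃ * Real.sqrt (Real.log (t / 2)) + 1) ^ 2 / 2) := by
    rw [hrpow, ← Real.exp_log (half_pos ht0), Real.log_exp, ← Real.exp_add, Real.exp_le_exp, hlt, hα]
    generalize Real.log (t / 2) = L at hu
    generalize Real.sqrt L = u at hu
    rw [add_sq, mul_pow, hu, hC₃]
    nlinarith [sq_nonneg (u / 2 - C₃), Real.log_two_gt_d9]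
  rw [hQ, hC₂]
  calc 2 * (1 / (2 ^ ((13 : ℝ) / 4 + C₃ ^ 2 / 2) * C₃ * Real.sqrt (2 * π))) * t ^ α
      = (Real.sqrt (2 * π))⁻¹ * (2 * t ^ α / 2 ^ ((13 : ℝ) / 4 + C₃ ^ 2 / 2) / C₃) := by
        field_simp
    _ ≤ (Real.sqrt (2 * π))⁻¹ * (2 * t ^ α / 2 ^ ((13 : ℝ) / 4 + C₃ ^ 2 / 2)) := by
        refine mul_le_mul_of_nonneg_left ?_ (by positivity)
        exact div_le_self (by positivity) hC₃one
    _ ≤ (Real.sqrt (2 * π))⁻¹ *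
          (t / 2 * ∫ z in Set.Ioi (C₃ * Real.sqrt (Real.log (t / 2))),
            Real.exp (-z ^ 2 / 2)) := by
        gcongr
        exact hexp.trans (by gcongr)
    _ = _ := by ring
end
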